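/- Let (f, A, C) be an a-orbit of the mini-boson-star system with parameters a > 0, α > 1, defined on [0, x̄) with x̄ < ∞, that crashes at x̄ (i.e., A(x) > 0 on [0, x̄) and lim_{x→x̄⁻} A(x) = 0). Then g = 1 − A C² is positive near the crash: there exists x₁ < x̄ such that g(x) > 0 for all x in (x₁, x̄). -/

import Mathlib

open Real Set Filter Topology MeasureTheory

noncomputable section

/-- The mini-boson-star ODE system for `f, A, C` on a set `s ⊆ (0, ∞)`
(prime denotes `d/dx`):
`(x² f'/C)' = (x²/(A C))·(1 − A C²)·f`,
`A' = (1 − A)/x − x·(A f'² + A C² f² + f²)`,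
`C' = (C/(x A))·(A − 1 + x² f²)`, with `A > 0` and `C > 0`. -/
def MiniBosonSystem (f A C : ℝ → ℝ) (s : Set ℝ) : Prop :=
  ∀ x ∈ s, 0 < x ∧ 0 < A x ∧ 0 < C x ∧
    DifferentiableAt ℝ f x ∧ DifferentiableAt ℝ (deriv f) x ∧
    DifferentiableAt ℝ A x ∧ DifferentiableAt ℝ C x ∧
    deriv (fun y => y ^ 2 * deriv f y / C y) x
      = x ^ 2 / (A x * C x) * (1 - A x * C x ^ 2) * f x ∧
    deriv A x = (1 - A x) / x
      - x * (A x * deriv f x ^ 2 + A x * C x ^ 2 * f x ^ 2 + f x ^ 2) ∧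
    deriv C x = C x / (x * A x) * (A x - 1 + x ^ 2 * f x ^ 2)

/-- A domain of the form `[0, x̄)` with `0 < x̄ ≤ ∞`. -/
def IsOrbitDomain (s : Set ℝ) : Prop :=
  s = Set.Ici (0 : ℝ) ∨ ∃ xbar > (0 : ℝ), s = Set.Ico 0 xbar

/-- An `a`-orbit of the mini-boson-star system with parameters `a, α` on the
domain `s = [0, x̄)`: a solution of the system on `s \ {0}`, continuous up to
`x = 0` with `f` differentiable at `0`, satisfying `f 0 = a`, `f' 0 = 0`,
`A 0 = 1`, `C 0 = α`. -/
def IsAOrbit (f A C : ℝ → ℝ) (a α : ℝ) (s : Set ℝ) : Prop :=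
  IsOrbitDomain s ∧
  MiniBosonSystem f A C (s \ {0}) ∧
  ContinuousWithinAt f s 0 ∧ ContinuousWithinAt A s 0 ∧ ContinuousWithinAt C s 0 ∧
  HasDerivWithinAt f 0 s 0 ∧
  f 0 = a ∧ A 0 = 1 ∧ C 0 = α

/-- The mass function `M(x) = x (1 − A x)/2`. -/
def massFn (A : ℝ → ℝ) (x : ℝ) : ℝ := x * (1 - A x) / 2

/-- `θ` is the rotation function of the orbit with scalar field `f`:
`θ` is continuous on the domain, `θ 0 = 0`, and for every `x` in the domain
there is `ρ x > 0` with `f x = ρ x · cos (θ x)` and `f' x = −ρ x · sin (θ x)`. -/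
def IsRotation (f θ : ℝ → ℝ) (s : Set ℝ) : Prop :=
  ContinuousOn θ s ∧ θ 0 = 0 ∧
  ∀ x ∈ s, ∃ ρ > (0 : ℝ), f x = ρ * Real.cos (θ x) ∧ deriv f x = -(ρ * Real.sin (θ x))

/-- The derivative of `A C²` along the mini-boson-star system. -/
theorem MiniBosonSystem.hasDerivAt_mul_sq {f A C : ℝ → ℝ} {s : Set ℝ}
    (h : MiniBosonSystem f A C s) {x : ℝ} (hx : x ∈ s) :
    HasDerivAt (fun y => A y * C y ^ 2)
      (C x ^ 2 * ((A x - 1) / x + x * f x ^ 2 * (1 - A x * C x ^ 2)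
        - x * A x * deriv f x ^ 2)) x := by
  obtain ⟨h0, hA, hC, -, -, dA, dC, -, eA, eC⟩ := h x hx
  refine (dA.hasDerivAt.fun_mul (dC.hasDerivAt.fun_pow 2)).congr_deriv ?_
  rw [eA, eC]
  field_simp
  ring

/-- Along the mini-boson-star system, `A C²` stays below `1` once it is below `1`,
as long as `A < 1`. -/
theorem MiniBosonSystem.mul_sq_lt_one {f A C : ℝ → ℝ} {x₁ b : ℝ}
    (h : MiniBosonSystem f A C (Ico x₁ b)) (hA : ∀ x ∈ Ico x₁ b, A x < 1)
    (h₁ : A x₁ * C x₁ ^ 2 < 1) : ∀ x ∈ Ico x₁ b, A x * C x ^ 2 < 1 := by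
  have key : ∀ x ∈ Ico x₁ b, A x * C x ^ 2 = 1 →
      C x ^ 2 * ((A x - 1) / x + x * f x ^ 2 * (1 - A x * C x ^ 2)
        - x * A x * deriv f x ^ 2) < 0 := by
    intro x hx hw
    obtain ⟨h0, hA0, hC, -⟩ := h x hx
    have h1 : (A x - 1) / x < 0 := div_neg_of_neg_of_pos (by linarith [hA x hx]) h0
    have h2 : 0 ≤ x * A x * deriv f x ^ 2 := by positivity
    rw [hw]
    exact mul_neg_of_pos_of_neg (by positivity) (by linarith)
  have hle : ∀ x ∈ Ico x₁ b, A x * C x ^ 2 ≤ 1 := by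
    intro x hx
    have hsub : ∀ y ∈ Icc x₁ x, y ∈ Ico x₁ b := fun y hy => ⟨hy.1, hy.2.trans_lt hx.2⟩
    exact image_le_of_deriv_right_lt_deriv_boundary (f := fun y => A y * C y ^ 2)
      (B := fun _ => 1) (B' := fun _ => 0)
      (fun y hy => (h.hasDerivAt_mul_sq (hsub y hy)).continuousAt.continuousWithinAt)
      (fun y hy => (h.hasDerivAt_mul_sq (hsub y ⟨hy.1, hy.2.le⟩)).hasDerivWithinAt)
      h₁.le (fun y => hasDerivAt_const y 1)
      (fun y hy => key y (hsub y ⟨hy.1, hy.2.le⟩)) ⟨hx.1, le_rfl⟩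
  intro x hx
  refine lt_of_le_of_ne (hle x hx) fun hw => ?_
  have hne : x₁ ≠ x := by
    rintro rfl
    exact h₁.ne hw
  have hmax : IsLocalMax (fun y => A y * C y ^ 2) x := by
    filter_upwards [Ioo_mem_nhds (lt_of_le_of_ne hx.1 hne) hx.2] with y hy
    exact (hle y ⟨hy.1.le, hy.2⟩).trans hw.ge
  exact (key x hx hw).ne (hmax.hasDerivAt_eq_zero (h.hasDerivAt_mul_sq hx))

/-- A function whose derivative is nonpositive on `[a, b)` is antitone there. -/
theorem antitoneOn_Ico_of_hasDerivAt_nonpos {F F' : ℝ → ℝ} {a b : ℝ}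
    (hF : ∀ x ∈ Ico a b, HasDerivAt F (F' x) x) (hF' : ∀ x ∈ Ico a b, F' x ≤ 0) :
    AntitoneOn F (Ico a b) := by
  refine antitoneOn_of_hasDerivWithinAt_nonpos (f' := F') (convex_Ico a b)
    (fun x hx => (hF x hx).continuousAt.continuousWithinAt) (fun x hx => ?_) (fun x hx => ?_)
  · exact (hF x (interior_subset hx)).hasDerivWithinAt
  · exact hF' x (interior_subset hx)

/-- A function is bounded on `[a, b)` if its derivative is dominated by a multiple of the rate
of decrease of a nonnegative function. -/
theorem abs_le_of_abs_deriv_le_neg_deriv {F F' L L' : ℝ → ℝ} {a b K : ℝ}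
    (hF : ∀ x ∈ Ico a b, HasDerivAt F (F' x) x) (hL : ∀ x ∈ Ico a b, HasDerivAt L (L' x) x)
    (hK : 0 ≤ K) (hL0 : ∀ x ∈ Ico a b, 0 ≤ L x)
    (hle : ∀ x ∈ Ico a b, |F' x| ≤ K * -L' x) :
    ∀ x ∈ Ico a b, |F x| ≤ |F a| + K * L a := by
  intro x hx
  have ha : a ∈ Ico a b := ⟨le_rfl, hx.1.trans_lt hx.2⟩
  have h1 := antitoneOn_Ico_of_hasDerivAt_nonpos (fun y hy => (hF y hy).fun_add ((hL y hy).const_mul K))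
    (fun y hy => by linarith [le_abs_self (F' y), hle y hy]) ha hx hx.1
  have h2 := antitoneOn_Ico_of_hasDerivAt_nonpos
    (fun y hy => (hF y hy).fun_neg.fun_add ((hL y hy).const_mul K))
    (fun y hy => by linarith [neg_le_abs (F' y), hle y hy]) ha hx hx.1
  have h3 : 0 ≤ K * L x := mul_nonneg hK (hL0 x hx)
  rw [abs_le]
  constructor <;> linarith [le_abs_self (F a), neg_le_abs (F a)]

/-- A nonnegative function on `[a, b)` cannot decrease at a rate at least `c / (b - x)`. -/
theorem not_forall_deriv_le_neg_div_sub {L L' : ℝ → ℝ} {a b c : ℝ} (hab : a < b) (hc : 0 < c)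
    (hL : ∀ x ∈ Ico a b, HasDerivAt L (L' x) x) (hL0 : ∀ x ∈ Ico a b, 0 ≤ L x)
    (hle : ∀ x ∈ Ico a b, L' x ≤ -(c / (b - x))) : False := by
  have hanti : AntitoneOn (fun x => L x - c * Real.log (b - x)) (Ico a b) := by
    refine antitoneOn_Ico_of_hasDerivAt_nonpos (F' := fun x => L' x - c * (-1 / (b - x)))
      (fun x hx => (hL x hx).fun_sub
        ((((hasDerivAt_id' x).const_sub b).log (sub_pos.2 hx.2).ne').const_mul c))
      (fun x hx => ?_)
    have h1 := hle x hx
    have h2 : c * (-1 / (b - x)) = -(c / (b - x)) := by ring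
    linarith
  set D := L a - c * Real.log (b - a) with hD
  have hpos : ∀ t, 0 < t → t ≤ b - a → 0 ≤ D + c * Real.log t := by
    intro t ht htb
    have hx : b - t ∈ Ico a b := ⟨by linarith, by linarith⟩
    have h1 := hanti ⟨le_rfl, hab⟩ hx hx.1
    have h2 := hL0 _ hx
    simp only [sub_sub_cancel] at h1
    linarith
  have hlim : Tendsto (fun t => D + c * Real.log t) (𝓝[>] 0) atBot :=
    tendsto_atBot_add_const_left _ _ (Real.tendsto_log_nhdsGT_zero.const_mul_atBot hc)
  obtain ⟨t, ht1, ht2⟩ :=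
    ((hlim.eventually_lt_atBot 0).and (Ioc_mem_nhdsGT (sub_pos.2 hab))).exists
  linarith [hpos t ht2.1 ht2.2]

/-- A function on `[a, b)` tending to `0` at `b` with derivative at least `-K` is bounded above
by `K (b - x)`. -/
theorem le_mul_sub_of_neg_le_deriv {A A' : ℝ → ℝ} {a b K : ℝ}
    (hA : ∀ x ∈ Ico a b, HasDerivAt A (A' x) x) (hK : ∀ x ∈ Ico a b, -K ≤ A' x)
    (hlim : Tendsto A (𝓝[<] b) (𝓝 0)) : ∀ x ∈ Ico a b, A x ≤ K * (b - x) := by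
  intro x hx
  have hanti : AntitoneOn (fun y => K * (b - y) - A y) (Ico a b) :=
    antitoneOn_Ico_of_hasDerivAt_nonpos
      (fun y hy => (((hasDerivAt_id' y).const_sub b).const_mul K).fun_sub (hA y hy))
      (fun y hy => by linarith [hK y hy])
  have hlim' : Tendsto (fun y => K * (b - y) - A y) (𝓝[<] b) (𝓝 (K * (b - b) - 0)) :=
    ((by fun_prop : Continuous fun y : ℝ => K * (b - y)).tendsto b |>.mono_left
      nhdsWithin_le_nhds).sub hlim
  have h1 : K * (b - b) - 0 ≤ K * (b - x) - A x := by
    refine le_of_tendsto hlim' ?_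
    filter_upwards [Ioo_mem_nhdsLT hx.2] with y hy
    exact hanti hx ⟨hx.1.trans hy.1.le, hy.2⟩ hy.1.le
  linarith

/-- A solution of the mini-boson-star system crashing at `b` cannot satisfy `1 ≤ A C²` up to
the crash. -/
theorem MiniBosonSystem.not_forall_one_le_mul_sq {f A C : ℝ → ℝ} {x₀ b : ℝ} (hx₀ : x₀ < b)
    (h : MiniBosonSystem f A C (Ico x₀ b)) (hA : ∀ x ∈ Ico x₀ b, A x < 1 / 2)
    (hcrash : Tendsto A (𝓝[<] b) (𝓝 0)) (hw : ∀ x ∈ Ico x₀ b, 1 ≤ A x * C x ^ 2) :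
    False := by
  have hm : x₀ ∈ Ico x₀ b := ⟨le_rfl, hx₀⟩
  have hx₀0 : 0 < x₀ := (h x₀ hm).1
  have hb : 0 < b := hx₀0.trans hx₀
  let L' : ℝ → ℝ := fun x => C x ^ 2 * ((A x - 1) / x + x * f x ^ 2 * (1 - A x * C x ^ 2)
        - x * A x * deriv f x ^ 2) / (A x * C x ^ 2)
  have hL : ∀ x ∈ Ico x₀ b, HasDerivAt (fun y => Real.log (A y * C y ^ 2)) (L' x) x :=
    fun x hx => (h.hasDerivAt_mul_sq hx).log (by linarith [hw x hx])
  have hL0 : ∀ x ∈ Ico x₀ b, 0 ≤ Real.log (A x * C x ^ 2) := fun x hx => Real.log_nonneg (hw x hx)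
  have hrate : ∀ x ∈ Ico x₀ b, 1 / (2 * b * A x) + x₀ * deriv f x ^ 2 ≤ -L' x := by
    intro x hx
    obtain ⟨h0, hA0, hC, -⟩ := h x hx
    have e : -L' x = (1 - A x) / (x * A x) + x * f x ^ 2 * (A x * C x ^ 2 - 1) / A x
        + x * deriv f x ^ 2 := by
      simp only [L']
      field_simp
      ring
    have h1 : 1 / (2 * b * A x) ≤ (1 - A x) / (x * A x) := by
      rw [div_le_div_iff₀ (by positivity) (by positivity)]
      have := hA x hx
      have : x * A x ≤ b * A x := mul_le_mul_of_nonneg_right hx.2.le hA0.le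
      nlinarith [mul_pos hb hA0]
    have h2 : 0 ≤ x * f x ^ 2 * (A x * C x ^ 2 - 1) / A x := by
      have := sub_nonneg.2 (hw x hx)
      positivity
    have h3 : x₀ * deriv f x ^ 2 ≤ x * deriv f x ^ 2 := by gcongr; exact hx.1
    linarith
  have hrate1 : ∀ x ∈ Ico x₀ b, 1 / A x ≤ 2 * b * -L' x := by
    intro x hx
    have h0 : 0 ≤ x₀ * deriv f x ^ 2 := by positivity
    calc 1 / A x = 2 * b * (1 / (2 * b * A x)) := by field_simp
      _ ≤ 2 * b * -L' x := by gcongr; linarith [hrate x hx]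
  have hW : ∀ x ∈ Ico x₀ b, A x * C x ^ 2 ≤ A x₀ * C x₀ ^ 2 := by
    intro x hx
    have h1 := antitoneOn_Ico_of_hasDerivAt_nonpos hL (fun y hy => by
      have := hrate1 y hy
      have h2 : 0 < 1 / A y := one_div_pos.2 (h y hy).2.1
      nlinarith) hm hx hx.1
    exact (Real.log_le_log_iff (by linarith [hw x hx]) (by linarith [hw x₀ hm])).1 h1
  set W := A x₀ * C x₀ ^ 2
  have hW1 : 1 ≤ W := hw x₀ hm
  obtain ⟨F, hF⟩ : ∃ F, ∀ x ∈ Ico x₀ b, |f x| ≤ F := by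
    refine ⟨_, abs_le_of_abs_deriv_le_neg_deriv (K := 2 * b + 1 / x₀)
      (fun x hx => (h x hx).2.2.2.1.hasDerivAt) hL (by positivity) hL0 fun x hx => ?_⟩
    have hA0 := (h x hx).2.1
    have h1 : 1 ≤ 1 / A x := by
      rw [le_div_iff₀ hA0]
      linarith [hA x hx]
    have h2 : deriv f x ^ 2 ≤ 1 / x₀ * -L' x := by
      have h3 : 0 ≤ 1 / (2 * b * A x) := by positivity
      rw [one_div_mul_eq_div, le_div_iff₀ hx₀0]
      linarith [hrate x hx]
    have h4 : |deriv f x| ≤ 1 + deriv f x ^ 2 := by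
      rw [← sq_abs]
      nlinarith [sq_nonneg (|deriv f x| - 1), abs_nonneg (deriv f x)]
    linarith [hrate1 x hx]
  have hF0 : 0 ≤ F := (abs_nonneg _).trans (hF x₀ hm)
  obtain ⟨P, hP⟩ : ∃ P, ∀ x ∈ Ico x₀ b, |x ^ 2 * deriv f x / C x| ≤ P := by
    refine ⟨_, abs_le_of_abs_deriv_le_neg_deriv (K := b ^ 2 * W * F * (2 * b))
      (F := fun y => y ^ 2 * deriv f y / C y)
      (F' := fun x => x ^ 2 / (A x * C x) * (1 - A x * C x ^ 2) * f x)
      (fun x hx => ?_) hL (by positivity) hL0 fun x hx => ?_⟩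
    · obtain ⟨h0, hA0, hC, df, ddf, dA, dC, ep, -⟩ := h x hx
      rw [← ep]
      exact (((differentiableAt_id.pow 2).mul ddf).div dC hC.ne').hasDerivAt
    · obtain ⟨h0, hA0, hC, -⟩ := h x hx
      have h1 : A x ≤ A x * C x := by
        refine le_mul_of_one_le_right hA0.le ?_
        by_contra! hlt
        have : C x ^ 2 ≤ 1 := pow_le_one₀ hC.le hlt.le
        nlinarith [hw x hx, hA x hx]
      have h2 : |1 - A x * C x ^ 2| ≤ W := by
        rw [abs_le]
        constructor <;> linarith [hW x hx, hw x hx]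
      calc |x ^ 2 / (A x * C x) * (1 - A x * C x ^ 2) * f x|
          = x ^ 2 / (A x * C x) * |1 - A x * C x ^ 2| * |f x| := by
            rw [abs_mul, abs_mul, abs_of_pos (by positivity : 0 < x ^ 2 / (A x * C x))]
        _ ≤ b ^ 2 / A x * W * F := by
            have := hx.2.le
            have := hF x hx
            gcongr
        _ = b ^ 2 * W * F * (1 / A x) := by ring
        _ ≤ b ^ 2 * W * F * (2 * b * -L' x) := by
            gcongr
            exact hrate1 x hx
        _ = b ^ 2 * W * F * (2 * b) * -L' x := by ring
  have hP0 : 0 ≤ P := (abs_nonneg _).trans (hP x₀ hm)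
  set K := b * (W * P ^ 2 / x₀ ^ 4 + W * F ^ 2 + F ^ 2) + 1
  have hK : 0 < K := by positivity
  have hAK : ∀ x ∈ Ico x₀ b, A x ≤ K * (b - x) := by
    refine le_mul_sub_of_neg_le_deriv (A' := deriv A)
      (fun x hx => (h x hx).2.2.2.2.2.1.hasDerivAt) (fun x hx => ?_) hcrash
    obtain ⟨h0, hA0, hC, -, -, -, -, -, eA, -⟩ := h x hx
    have h1 : 0 ≤ (1 - A x) / x := div_nonneg (by linarith [hA x hx]) h0.le
    have hf2 : f x ^ 2 ≤ F ^ 2 := sq_le_sq' (by linarith [abs_le.1 (hF x hx)]) (abs_le.1 (hF x hx)).2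
    have hp2 : (x ^ 2 * deriv f x / C x) ^ 2 ≤ P ^ 2 :=
      sq_le_sq' (by linarith [abs_le.1 (hP x hx)]) (abs_le.1 (hP x hx)).2
    have h2 : A x * deriv f x ^ 2 ≤ W * P ^ 2 / x₀ ^ 4 := by
      calc A x * deriv f x ^ 2
          = A x * C x ^ 2 * (x ^ 2 * deriv f x / C x) ^ 2 / x ^ 4 := by field_simp
        _ ≤ W * P ^ 2 / x₀ ^ 4 := by
          have := hW x hx
          have := hx.1
          gcongr
    have h3 : A x * C x ^ 2 * f x ^ 2 ≤ W * F ^ 2 := by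
      have := hW x hx
      gcongr
    have h4 : x * (A x * deriv f x ^ 2 + A x * C x ^ 2 * f x ^ 2 + f x ^ 2)
        ≤ b * (W * P ^ 2 / x₀ ^ 4 + W * F ^ 2 + F ^ 2) := by
      have := hx.2.le
      gcongr
    rw [eA]
    simp only [K]
    linarith
  refine not_forall_deriv_le_neg_div_sub (c := 1 / (2 * b * K)) hx₀ (by positivity) hL hL0
    fun x hx => ?_
  have hA0 := (h x hx).2.1
  have h0 : 0 ≤ x₀ * deriv f x ^ 2 := by positivity
  have h1 : 1 / (2 * b * K) / (b - x) ≤ 1 / (2 * b * A x) := by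
    rw [div_div, mul_assoc (2 * b)]
    have := hAK x hx
    gcongr
  linarith [hrate x hx]

/-- If an `a`-orbit on `[0, x̄)` with `x̄ < ∞` crashes at `x̄`
(`A → 0` as `x → x̄⁻`), then `g = 1 − A C²` is positive near the crash. -/
theorem g_positive_near_crash (f A C : ℝ → ℝ) (a α xbar : ℝ)
    (ha : 0 < a) (hα : 1 < α) (hxbar : 0 < xbar)
    (horbit : IsAOrbit f A C a α (Set.Ico 0 xbar))
    (hcrash : Filter.Tendsto A (nhdsWithin xbar (Set.Iio xbar)) (nhds 0)) :
    ∃ x₁ < xbar, ∀ x : ℝ, x₁ < x → x < xbar → 0 < 1 - A x * C x ^ 2 := by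
  have hsys := horbit.2.1
  obtain ⟨y, hy, hyA⟩ := (mem_nhdsLT_iff_exists_Ioo_subset' hxbar).1
    (hcrash.eventually_lt_const (by norm_num : (0 : ℝ) < 1 / 2))
  obtain ⟨x₀, hx₀, hx₀b⟩ := exists_between (max_lt hxbar hy)
  obtain ⟨hx₀0, hx₀y⟩ := max_lt_iff.1 hx₀
  have hA : ∀ x ∈ Ico x₀ xbar, A x < 1 / 2 := fun x hx => hyA ⟨hx₀y.trans_le hx.1, hx.2⟩
  have hsys₀ : MiniBosonSystem f A C (Ico x₀ xbar) := fun x hx =>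
    hsys x ⟨⟨hx₀0.le.trans hx.1, hx.2⟩, (hx₀0.trans_le hx.1).ne'⟩
  by_cases hw : ∀ x ∈ Ico x₀ xbar, 1 ≤ A x * C x ^ 2
  · exact (hsys₀.not_forall_one_le_mul_sq hx₀b hA hcrash hw).elim
  · push Not at hw
    obtain ⟨x₁, hx₁, hw₁⟩ := hw
    have hsub : ∀ x ∈ Ico x₁ xbar, x ∈ Ico x₀ xbar := fun x hx => ⟨hx₁.1.trans hx.1, hx.2⟩
    refine ⟨x₁, hx₁.2, fun x h1 h2 => sub_pos.2 ?_⟩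
    exact MiniBosonSystem.mul_sq_lt_one (fun x hx => hsys₀ x (hsub x hx))
      (fun x hx => (hA x (hsub x hx)).trans (by norm_num)) hw₁ x ⟨h1.le, h2⟩
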